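/- arXiv:2409.16687 — 2 statements merged into one kernel-verified Lean document; each statement's English description precedes it below -/
import Mathlib

section
/- For every ε > 0 there exists r₀ such that for every integer r ≥ r₀ and every interval I ⊆ [0, r] of length |I| ≥ r^{1 - 1/100}, one has |∑_{v ∈ I, v integer} 1_{gcd(v,r)=1} − φ(r)·|I|/r| ≤ ε · φ(r)·|I|/r. -/
open scoped Classical

/-- The natural numbers in `[x, y]` divisible by no element of `P`. -/
noncomputable def sifted (P : Finset ℕ) (x y : ℝ) : Finset ℕ :=
  {v ∈ Finset.Icc ⌈x⌉₊ ⌊y⌋₊ | ∀ p ∈ P, ¬ p ∣ v}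

theorem mem_sifted {P : Finset ℕ} {x y : ℝ} (hy : 0 ≤ y) {v : ℕ} :
    v ∈ sifted P x y ↔ (x ≤ v ∧ (v : ℝ) ≤ y) ∧ ∀ p ∈ P, ¬ p ∣ v := by
  simp [sifted, Nat.le_floor_iff hy]

theorem card_sifted_insert {P : Finset ℕ} {p : ℕ} (hp : p.Prime) (hP : ∀ q ∈ P, q.Prime)
    (hpP : p ∉ P) {x y : ℝ} (hy : 0 ≤ y) :
    (sifted (insert p P) x y).card + (sifted P (x / p) (y / p)).card = (sifted P x y).card := by
  have hp0 : (0 : ℝ) < p := by exact_mod_cast hp.pos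
  have hyp : 0 ≤ y / p := by positivity
  have hdvd : {v ∈ sifted P x y | p ∣ v} = (sifted P (x / p) (y / p)).image (p * ·) := by
    ext v
    simp only [Finset.mem_filter, Finset.mem_image, mem_sifted hy, mem_sifted hyp,
      div_le_iff₀ hp0, le_div_iff₀ hp0]
    constructor
    · rintro ⟨⟨⟨h1, h2⟩, h3⟩, w, rfl⟩
      push_cast at h1 h2
      exact ⟨w, ⟨⟨by linarith, by linarith⟩, fun q hq h => h3 q hq (h.mul_left p)⟩, rfl⟩
    · rintro ⟨w, ⟨⟨h1, h2⟩, h3⟩, rfl⟩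
      refine ⟨⟨⟨by push_cast; linarith, by push_cast; linarith⟩, fun q hq h => ?_⟩, dvd_mul_right p w⟩
      rcases (hP q hq).dvd_mul.1 h with h | h
      · exact hpP ((Nat.prime_dvd_prime_iff_eq (hP q hq) hp).1 h ▸ hq)
      · exact h3 q hq h
  have hndvd : {v ∈ sifted P x y | ¬ p ∣ v} = sifted (insert p P) x y := by
    ext v
    simp only [Finset.mem_filter, mem_sifted hy, Finset.forall_mem_insert]
    tauto
  rw [← Finset.card_filter_add_card_filter_not (s := sifted P x y) (fun v => p ∣ v), hdvd, hndvd,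
    Finset.card_image_of_injective _ (mul_right_injective₀ hp.ne_zero), add_comm]

theorem abs_card_sifted_empty_sub_le {x y : ℝ} (hx : 0 ≤ x) (hxy : x ≤ y) :
    |((sifted ∅ x y).card : ℝ) - (y - x)| ≤ 1 := by
  have h1 := Nat.ceil_lt_add_one hx
  have h2 := Nat.le_ceil x
  have h3 := Nat.floor_le (hx.trans hxy)
  have h4 := Nat.lt_floor_add_one y
  have h5 : ⌈x⌉₊ ≤ ⌊y⌋₊ + 1 := by
    have : (⌈x⌉₊ : ℝ) < ⌊y⌋₊ + 2 := by linarith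
    have : ⌈x⌉₊ < ⌊y⌋₊ + 2 := by exact_mod_cast this
    omega
  have h6 : (sifted ∅ x y).card = ⌊y⌋₊ + 1 - ⌈x⌉₊ := by simp [sifted]
  rw [h6, Nat.cast_sub h5, abs_le]
  push_cast
  constructor <;> linarith

/-- The Legendre sieve. -/
theorem abs_card_sifted_sub_le (P : Finset ℕ) (hP : ∀ q ∈ P, q.Prime) {x y : ℝ}
    (hx : 0 ≤ x) (hxy : x ≤ y) :
    |((sifted P x y).card : ℝ) - (y - x) * ∏ p ∈ P, (1 - (p : ℝ)⁻¹)| ≤ 2 ^ P.card := by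
  induction P using Finset.induction_on generalizing x y with
  | empty => simpa using abs_card_sifted_empty_sub_le hx hxy
  | insert p P hpP ih =>
    rw [Finset.forall_mem_insert] at hP
    have h1 := abs_le.1 (ih hP.2 hx hxy)
    have h2 := abs_le.1 (ih hP.2 (x := x / p) (y := y / p) (by positivity) (by gcongr))
    have h3 : ((sifted (insert p P) x y).card : ℝ) + (sifted P (x / p) (y / p)).card
        = (sifted P x y).card := by
      exact_mod_cast card_sifted_insert hP.1 hP.2 hpP (hx.trans hxy)
    have h4 : (y - x) * ((1 - (p : ℝ)⁻¹) * ∏ q ∈ P, (1 - (q : ℝ)⁻¹))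
        = (y - x) * ∏ q ∈ P, (1 - (q : ℝ)⁻¹) - (y / p - x / p) * ∏ q ∈ P, (1 - (q : ℝ)⁻¹) := by
      ring
    rw [Finset.prod_insert hpP, Finset.card_insert_of_notMem hpP, h4, pow_succ, abs_le]
    constructor <;> linarith [h1.1, h1.2, h2.1, h2.2]

theorem coprime_iff_forall_primeFactors_not_dvd {v r : ℕ} (hr : r ≠ 0) :
    v.Coprime r ↔ ∀ p ∈ r.primeFactors, ¬ p ∣ v := by
  rw [← not_iff_not, Nat.Prime.not_coprime_iff_dvd]
  simp only [Nat.mem_primeFactors]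
  push Not
  exact ⟨fun ⟨p, h1, h2, h3⟩ => ⟨p, ⟨h1, h3, hr⟩, h2⟩, fun ⟨p, ⟨h1, h3, _⟩, h2⟩ => ⟨p, h1, h2, h3⟩⟩

theorem le_two_pow_card_primeFactors_mul_totient (r : ℕ) :
    r ≤ 2 ^ r.primeFactors.card * r.totient := by
  have hpos : 0 < ∏ p ∈ r.primeFactors, (p - 1) :=
    Finset.prod_pos fun p hp => Nat.sub_pos_of_lt (Nat.prime_of_mem_primeFactors hp).one_lt
  refine Nat.le_of_mul_le_mul_right ?_ hpos
  calc r * ∏ p ∈ r.primeFactors, (p - 1)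
      = r.totient * ∏ p ∈ r.primeFactors, p := (Nat.totient_mul_prod_primeFactors r).symm
    _ ≤ r.totient * ∏ p ∈ r.primeFactors, 2 * (p - 1) := by
        gcongr with p hp
        have := (Nat.prime_of_mem_primeFactors hp).two_le
        omega
    _ = 2 ^ r.primeFactors.card * r.totient * ∏ p ∈ r.primeFactors, (p - 1) := by
        rw [Finset.prod_mul_distrib, Finset.prod_const]
        ring

theorem pow_card_primeFactors_le (k : ℕ) {r : ℕ} (hr : r ≠ 0) :
    (k + 1) ^ r.primeFactors.card ≤ (k + 1) ^ (k + 1) * r := by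
  rw [← Finset.prod_const, ← Finset.prod_filter_mul_prod_filter_not r.primeFactors (· < k + 1)]
  gcongr
  · rw [Finset.prod_const]
    gcongr
    · omega
    · calc _ ≤ (Finset.range (k + 1)).card :=
            Finset.card_le_card fun p hp => Finset.mem_range.2 (Finset.mem_filter.1 hp).2
        _ = k + 1 := Finset.card_range _
  · calc ∏ p ∈ r.primeFactors with ¬ p < k + 1, (k + 1)
        ≤ ∏ p ∈ r.primeFactors with ¬ p < k + 1, p :=
          Finset.prod_le_prod' fun p hp => not_lt.1 (Finset.mem_filter.1 hp).2
      _ ≤ ∏ p ∈ r.primeFactors, p :=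
          Finset.prod_le_prod_of_subset_of_one_le' (Finset.filter_subset _ _)
            fun p hp _ => (Nat.prime_of_mem_primeFactors hp).one_le
      _ ≤ r := Nat.le_of_dvd (Nat.pos_of_ne_zero hr) (Nat.prod_primeFactors_dvd r)

theorem four_pow_card_primeFactors_le {r : ℕ} (hr : r ≠ 0) :
    (4 : ℝ) ^ r.primeFactors.card ≤ 4 ^ 16 * (r : ℝ) ^ (1 / 2 : ℝ) := by
  have h : (16 : ℝ) ^ r.primeFactors.card ≤ 16 ^ 16 * r := by
    exact_mod_cast pow_card_primeFactors_le 15 hr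
  refine (sq_le_sq₀ (by positivity) (by positivity)).1 ?_
  rw [← Real.sqrt_eq_rpow, mul_pow, Real.sq_sqrt (by positivity), ← pow_mul, mul_comm _ 2, pow_mul]
  norm_num at h ⊢
  exact h

theorem statement3 :
    ∀ ε : ℝ, 0 < ε → ∃ r₀ : ℕ, ∀ r : ℕ, r₀ ≤ r →
      ∀ x y : ℝ, 0 ≤ x → x ≤ y → y ≤ (r : ℝ) → (r : ℝ) ^ (1 - 1 / 100 : ℝ) ≤ y - x →
      |(((Finset.range (r + 1)).filter
            (fun v : ℕ => x ≤ (v : ℝ) ∧ (v : ℝ) ≤ y ∧ Nat.Coprime v r)).card : ℝ)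
          - (Nat.totient r : ℝ) * (y - x) / r|
        ≤ ε * ((Nat.totient r : ℝ) * (y - x) / r) := by
  intro ε hε
  have hlim : Filter.Tendsto (fun r : ℕ => (r : ℝ) ^ (49 / 100 : ℝ)) Filter.atTop Filter.atTop :=
    (tendsto_rpow_atTop (by norm_num)).comp tendsto_natCast_atTop_atTop
  obtain ⟨r₀, hr₀⟩ := Filter.eventually_atTop.1
    ((hlim.eventually_ge_atTop (4 ^ 16 / ε)).and (Filter.eventually_ge_atTop 1))
  refine ⟨r₀, fun r hr x y hx hxy hyr hlen => ?_⟩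
  obtain ⟨hlarge, hr1⟩ := hr₀ r hr
  have hr0 : r ≠ 0 := by omega
  have hrpos : (0 : ℝ) < r := by positivity
  have hset : (Finset.range (r + 1)).filter
      (fun v : ℕ => x ≤ (v : ℝ) ∧ (v : ℝ) ≤ y ∧ Nat.Coprime v r) = sifted r.primeFactors x y := by
    ext v
    rw [Finset.mem_filter, mem_sifted (hx.trans hxy), coprime_iff_forall_primeFactors_not_dvd hr0,
      Finset.mem_range, and_assoc, and_iff_right_iff_imp]
    rintro ⟨-, h, -⟩
    have : (v : ℝ) ≤ r := h.trans hyr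
    exact Nat.lt_succ_of_le (by exact_mod_cast this)
  have htot : (r.totient : ℝ) = r * ∏ p ∈ r.primeFactors, (1 - (p : ℝ)⁻¹) := by
    have h := congrArg (Rat.cast : ℚ → ℝ) (Nat.totient_eq_mul_prod_factors r)
    push_cast at h
    exact h
  have hmain : (r.totient : ℝ) * (y - x) / r = (y - x) * ∏ p ∈ r.primeFactors, (1 - (p : ℝ)⁻¹) := by
    rw [htot]
    field_simp
  rw [hset]
  nth_rewrite 1 [hmain]
  refine (abs_card_sifted_sub_le _ (fun q hq => Nat.prime_of_mem_primeFactors hq) hx hxy).trans ?_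
  have hφ : (r : ℝ) ≤ 2 ^ r.primeFactors.card * r.totient := by
    exact_mod_cast le_two_pow_card_primeFactors_mul_totient r
  have hω : (4 : ℝ) ^ r.primeFactors.card ≤ ε * (y - x) := by
    calc (4 : ℝ) ^ r.primeFactors.card ≤ 4 ^ 16 * (r : ℝ) ^ (1 / 2 : ℝ) :=
          four_pow_card_primeFactors_le hr0
      _ ≤ ε * (r : ℝ) ^ (49 / 100 : ℝ) * (r : ℝ) ^ (1 / 2 : ℝ) := by
          gcongr
          rwa [div_le_iff₀' hε] at hlarge
      _ = ε * (r : ℝ) ^ (1 - 1 / 100 : ℝ) := by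
          rw [mul_assoc, ← Real.rpow_add hrpos]
          norm_num
      _ ≤ ε * (y - x) := by gcongr
  have h4 : (4 : ℝ) ^ r.primeFactors.card = 2 ^ r.primeFactors.card * 2 ^ r.primeFactors.card := by
    rw [← mul_pow]
    norm_num
  rw [h4] at hω
  rw [← mul_div_assoc, le_div_iff₀ hrpos]
  calc (2 : ℝ) ^ r.primeFactors.card * r
      ≤ 2 ^ r.primeFactors.card * (2 ^ r.primeFactors.card * r.totient) := by gcongr
    _ = 2 ^ r.primeFactors.card * 2 ^ r.primeFactors.card * r.totient := by ring
    _ ≤ ε * (y - x) * r.totient := by gcongr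
    _ = ε * (r.totient * (y - x)) := by ring
end

section
/- For every ε > 0 there exists r₀ such that for every integer r ≥ r₀, every interval I ⊆ [0, r] of length |I| ≥ r^{1 - 1/100}, and every non-principal real quadratic Dirichlet character χ modulo r, one has |∑_{v ∈ I, v integer} χ(v)| ≤ ε · φ(r)·|I|/r. -/
open scoped Classical

open ZMod in
theorem DirichletCharacter.IsPrimitive.norm_gaussSum_stdAddChar {N : ℕ} [NeZero N]
    {χ : DirichletCharacter ℂ N} (hχ : χ.IsPrimitive) :
    ‖gaussSum χ (stdAddChar (N := N))‖ = √N := by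
  have hχ' : χ⁻¹.IsPrimitive := by
    rw [DirichletCharacter.isPrimitive_def, DirichletCharacter.conductor_inv]
    exact hχ
  have hprod : gaussSum χ (stdAddChar (N := N)) * gaussSum χ⁻¹ (stdAddChar (N := N))
      = N * χ (-1) := by
    have h1 : dft (χ : ZMod N → ℂ) =
        fun k ↦ χ⁻¹ (-k) * gaussSum χ (stdAddChar (N := N)) :=
      funext fun k ↦ hχ.fourierTransform_eq_inv_mul_gaussSum k
    have h2 := congrFun (dft_dft (χ : ZMod N → ℂ)) 1
    rw [h1, dft_mul_const, dft_comp_neg (fun k ↦ χ⁻¹ k)] at h2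
    have h3 := hχ'.fourierTransform_eq_inv_mul_gaussSum (-1)
    simp only [inv_inv, neg_neg, map_one, one_mul] at h3
    simp only [smul_eq_mul] at h2
    rw [← h2, h3, mul_comm]
  have hconj : ‖gaussSum χ⁻¹ (stdAddChar (N := N))‖ = ‖gaussSum χ (stdAddChar (N := N))‖ := by
    have h1 : (stdAddChar (N := N))⁻¹ = (stdAddChar (N := N)).mulShift ((-1 : (ZMod N)ˣ) : ZMod N) := by
      ext x
      simp [AddChar.mulShift_apply, AddChar.inv_apply]
    rw [← norm_star (gaussSum χ _), star_gaussSum_eq, h1, gaussSum_mulShift_eq, norm_mul,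
      DirichletCharacter.unit_norm_eq_one, one_mul]
  have hn := congrArg norm hprod
  rw [norm_mul, hconj, norm_mul] at hn
  have : ‖χ (-1)‖ = 1 := by
    simpa using DirichletCharacter.unit_norm_eq_one χ (-1)
  rw [this, mul_one, Complex.norm_natCast] at hn
  rw [← hn, Real.sqrt_mul_self (norm_nonneg _)]

theorem ZMod.four_mul_div_le_norm_stdAddChar_sub_one {N : ℕ} [NeZero N] (k : ZMod N) :
    4 * (k.val * (N - k.val) : ℝ) / N ^ 2 ≤ ‖stdAddChar k - 1‖ := by
  have hN : (0 : ℝ) < N := by exact_mod_cast NeZero.pos N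
  have hk : (k.val : ℝ) ≤ N := by exact_mod_cast k.val_lt.le
  obtain ⟨t, ht⟩ : ∃ t : ℝ, t = k.val / N := ⟨_, rfl⟩
  have ht0 : 0 ≤ t := by rw [ht]; positivity
  have ht1 : t ≤ 1 := by rw [ht]; exact (div_le_one hN).2 hk
  have hz : stdAddChar k = Complex.exp (Complex.I * (2 * Real.pi * t : ℝ)) := by
    have := stdAddChar_coe (N := N) (k.val : ℤ)
    rw [Int.cast_natCast, natCast_zmod_val] at this
    rw [this, ht]
    congr 1
    push_cast
    ring
  have hsin : 2 * (t * (1 - t)) ≤ Real.sin (Real.pi * t) := by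
    have hpi := Real.pi_pos
    rcases le_total t (1 / 2) with h | h
    · have := Real.mul_le_sin (x := Real.pi * t) (by positivity) (by nlinarith)
      have e : 2 / Real.pi * (Real.pi * t) = 2 * t := by field_simp
      nlinarith
    · have := Real.mul_le_sin (x := Real.pi * (1 - t)) (mul_nonneg hpi.le (by linarith))
        (by nlinarith)
      have e : 2 / Real.pi * (Real.pi * (1 - t)) = 2 * (1 - t) := by field_simp
      rw [e, show Real.pi * (1 - t) = Real.pi - Real.pi * t by ring, Real.sin_pi_sub] at this
      nlinarith
  rw [hz, Complex.norm_exp_I_mul_ofReal_sub_one]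
  refine le_trans ?_ (le_abs_self _)
  have e : 4 * (k.val * (N - k.val) : ℝ) / N ^ 2 = 2 * (2 * (t * (1 - t))) := by
    rw [ht]; field_simp; ring
  rw [e, show 2 * Real.pi * t / 2 = Real.pi * t by ring]
  linarith

theorem ZMod.norm_sum_Ico_stdAddChar_mul_le {N : ℕ} [NeZero N] {k : ZMod N} (hk : k ≠ 0)
    (a b : ℕ) :
    ‖∑ j ∈ Finset.Ico a b, stdAddChar (k * (j : ZMod N))‖
      ≤ N / 2 * ((k.val : ℝ)⁻¹ + ((N : ℝ) - k.val)⁻¹) := by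
  have hN : (0 : ℝ) < N := by exact_mod_cast NeZero.pos N
  have hk0 : (0 : ℝ) < k.val := by
    exact_mod_cast Nat.pos_of_ne_zero fun h ↦ hk ((ZMod.val_eq_zero k).1 h)
  have hkN : (0 : ℝ) < N - k.val := sub_pos.2 (by exact_mod_cast k.val_lt)
  have hlow := four_mul_div_le_norm_stdAddChar_sub_one k
  have hpos : 0 < 4 * (k.val * (N - k.val) : ℝ) / N ^ 2 := by positivity
  have hz : stdAddChar k ≠ 1 := by
    intro h
    rw [h, sub_self, norm_zero] at hlow
    linarith
  have hnorm : ∀ n : ℕ, ‖stdAddChar k ^ n‖ = 1 := fun n ↦ by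
    rw [norm_pow, stdAddChar_apply, Circle.norm_coe, one_pow]
  rcases lt_or_ge b a with h | hab
  · rw [Finset.Ico_eq_empty_of_le h.le, Finset.sum_empty, norm_zero]
    positivity
  have hterm : ∀ j ∈ Finset.Ico a b, stdAddChar (k * (j : ZMod N)) = stdAddChar k ^ j :=
    fun j _ ↦ by rw [← AddChar.map_nsmul_eq_pow, nsmul_eq_mul, mul_comm]
  rw [Finset.sum_congr rfl hterm, geom_sum_Ico hz hab, norm_div]
  calc _ ≤ 2 / (4 * (k.val * (N - k.val) : ℝ) / N ^ 2) := by
        refine div_le_div₀ zero_le_two ?_ hpos hlow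
        refine (norm_sub_le _ _).trans ?_
        rw [hnorm, hnorm]; norm_num
    _ = _ := by field_simp; ring

theorem ZMod.sum_val_inv_add_le (N : ℕ) [NeZero N] :
    ∑ k : ZMod N, ((k.val : ℝ)⁻¹ + ((N : ℝ) - k.val)⁻¹) ≤ 2 * (1 + Real.log N) := by
  have hsum : ∑ k : ZMod N, ((k.val : ℝ)⁻¹ + ((N : ℝ) - k.val)⁻¹)
      = ∑ i ∈ Finset.range N, ((i : ℝ)⁻¹ + ((N : ℝ) - i)⁻¹) := by
    obtain ⟨n, rfl⟩ := Nat.exists_eq_succ_of_ne_zero (NeZero.ne N)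
    exact Fin.sum_univ_eq_sum_range
      (fun i : ℕ ↦ ((i : ℝ)⁻¹ + (((n + 1 : ℕ) : ℝ) - i)⁻¹)) (n + 1)
  have hh := harmonic_le_one_add_log N
  have hH : ((harmonic N : ℚ) : ℝ) = ∑ i ∈ Finset.range N, ((i + 1 : ℕ) : ℝ)⁻¹ := by
    simp [harmonic]
  have h1 : ∑ i ∈ Finset.range N, (i : ℝ)⁻¹ ≤ ∑ i ∈ Finset.range N, ((i + 1 : ℕ) : ℝ)⁻¹ := by
    have := Finset.sum_range_succ (fun i : ℕ ↦ (i : ℝ)⁻¹) N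
    rw [Finset.sum_range_succ'] at this
    simp only [Nat.cast_zero, _root_.inv_zero, _root_.add_zero] at this
    rw [this]
    exact le_add_of_nonneg_right (by positivity)
  have h2 : ∑ i ∈ Finset.range N, ((N : ℝ) - i)⁻¹
      = ∑ i ∈ Finset.range N, ((i + 1 : ℕ) : ℝ)⁻¹ := by
    rw [← Finset.sum_range_reflect (fun i : ℕ ↦ ((i + 1 : ℕ) : ℝ)⁻¹)]
    refine Finset.sum_congr rfl fun i hi ↦ ?_
    have hi := Finset.mem_range.1 hi
    rw [show N - 1 - i + 1 = N - i by omega, Nat.cast_sub hi.le]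
  rw [hsum, Finset.sum_add_distrib, h2]
  rw [hH] at hh
  linarith

open ZMod in
/-- The **Pólya–Vinogradov inequality** for primitive characters. -/
theorem DirichletCharacter.IsPrimitive.norm_sum_Ico_le {N : ℕ} [NeZero N]
    {χ : DirichletCharacter ℂ N} (hχ : χ.IsPrimitive) (hN : N ≠ 1) (a b : ℕ) :
    ‖∑ j ∈ Finset.Ico a b, χ (j : ZMod N)‖ ≤ √N * (1 + Real.log N) := by
  have hN0 : (0 : ℝ) < N := by exact_mod_cast NeZero.pos N
  have hinv (j : ℕ) : (N : ℂ) * χ (j : ZMod N)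
      = ∑ k : ZMod N, stdAddChar (k * (j : ZMod N)) * dft (χ : ZMod N → ℂ) k := by
    have h := congrFun (dft_dft (χ : ZMod N → ℂ)) (-(j : ZMod N))
    rw [dft_apply] at h
    simpa using h.symm
  have hdft (k : ZMod N) : ‖dft (χ : ZMod N → ℂ) k‖ ≤ √N := by
    rw [hχ.fourierTransform_eq_inv_mul_gaussSum, norm_mul, hχ.norm_gaussSum_stdAddChar]
    exact mul_le_of_le_one_left (by positivity) (DirichletCharacter.norm_le_one _ _)
  have hdft0 : dft (χ : ZMod N → ℂ) 0 = 0 := by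
    rw [hχ.fourierTransform_eq_inv_mul_gaussSum, neg_zero,
      DirichletCharacter.map_zero' _ hN, zero_mul]
  have hexp : (N : ℂ) * ∑ j ∈ Finset.Ico a b, χ (j : ZMod N)
      = ∑ k : ZMod N, (∑ j ∈ Finset.Ico a b, stdAddChar (k * (j : ZMod N))) *
          dft (χ : ZMod N → ℂ) k := by
    simp_rw [Finset.mul_sum, hinv, Finset.sum_mul]
    exact Finset.sum_comm
  have hbound : (N : ℝ) * ‖∑ j ∈ Finset.Ico a b, χ (j : ZMod N)‖
      ≤ N * (√N * (1 + Real.log N)) := by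
    calc (N : ℝ) * ‖∑ j ∈ Finset.Ico a b, χ (j : ZMod N)‖
        = ‖(N : ℂ) * ∑ j ∈ Finset.Ico a b, χ (j : ZMod N)‖ := by
          rw [norm_mul, Complex.norm_natCast]
      _ ≤ ∑ k : ZMod N, (N / 2 * ((k.val : ℝ)⁻¹ + ((N : ℝ) - k.val)⁻¹)) * √N := by
          rw [hexp]
          refine norm_sum_le_of_le _ fun k _ ↦ ?_
          have hkN : (0 : ℝ) < N - k.val := sub_pos.2 (by exact_mod_cast k.val_lt)
          rcases eq_or_ne k 0 with rfl | hk
          · rw [hdft0, mul_zero, norm_zero]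
            positivity
          · rw [norm_mul]
            exact mul_le_mul (norm_sum_Ico_stdAddChar_mul_le hk a b) (hdft k)
              (norm_nonneg _) (by positivity)
      _ = N / 2 * √N * ∑ k : ZMod N, ((k.val : ℝ)⁻¹ + ((N : ℝ) - k.val)⁻¹) := by
          rw [Finset.mul_sum]
          exact Finset.sum_congr rfl fun k _ ↦ by ring
      _ ≤ N / 2 * √N * (2 * (1 + Real.log N)) := by
          gcongr
          exact sum_val_inv_add_le N
      _ = _ := by ring
  exact le_of_mul_le_mul_left hbound hN0

theorem Nat.card_divisors_le_two_mul_sqrt (n : ℕ) : (n.divisors.card : ℝ) ≤ 2 * √n := by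
  have hsub : n.divisors ⊆ Finset.Icc 1 n.sqrt ∪ (Finset.Icc 1 n.sqrt).image (n / ·) := by
    intro d hd
    obtain ⟨⟨e, rfl⟩, hn⟩ := Nat.mem_divisors.1 hd
    have hd0 : 0 < d := Nat.pos_of_ne_zero (left_ne_zero_of_mul hn)
    have he0 : 0 < e := Nat.pos_of_ne_zero (right_ne_zero_of_mul hn)
    rw [Finset.mem_union, Finset.mem_image]
    rcases le_total d e with h | h
    · exact .inl (Finset.mem_Icc.2 ⟨hd0, Nat.le_sqrt.2 (Nat.mul_le_mul_left d h)⟩)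
    · exact .inr ⟨e, Finset.mem_Icc.2 ⟨he0, Nat.le_sqrt.2 (Nat.mul_le_mul_right e h)⟩,
        Nat.mul_div_cancel _ he0⟩
  have hcard : n.divisors.card ≤ 2 * n.sqrt := by
    refine (Finset.card_le_card hsub).trans ((Finset.card_union_le _ _).trans ?_)
    have := Finset.card_image_le (s := Finset.Icc 1 n.sqrt) (f := (n / ·))
    rw [Nat.card_Icc, Nat.add_sub_cancel] at *
    omega
  calc (n.divisors.card : ℝ) ≤ 2 * n.sqrt := by exact_mod_cast hcard
    _ ≤ 2 * √n := by gcongr; exact Real.nat_sqrt_le_real_sqrt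

theorem Nat.sum_divisors_filter_dvd_moebius {m : ℕ} (hm : m ≠ 0) (v : ℕ) :
    ∑ d ∈ m.divisors with d ∣ v, ArithmeticFunction.moebius d
      = if m.Coprime v then 1 else 0 := by
  have hset : m.divisors.filter (· ∣ v) = (m.gcd v).divisors := by
    ext d
    simp [Nat.dvd_gcd_iff, hm]
  rw [hset, ← ArithmeticFunction.coe_mul_zeta_apply, ArithmeticFunction.moebius_mul_coe_zeta,
    ArithmeticFunction.one_apply]

theorem DirichletCharacter.apply_eq_ite_primitiveCharacter {R : Type*} [CommRing R] {r : ℕ}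
    (χ : DirichletCharacter R r) (v : ℕ) :
    χ (v : ZMod r)
      = if (r / χ.conductor).Coprime v then χ.primitiveCharacter (v : ZMod χ.conductor) else 0 := by
  have hr : χ.conductor * (r / χ.conductor) = r := Nat.mul_div_cancel' χ.conductor_dvd_level
  by_cases hv : r.Coprime v
  · have hv' : IsCoprime (v : ℤ) (r : ℤ) := Nat.isCoprime_iff_coprime.2 hv.symm
    rw [if_pos (hv.coprime_dvd_left (Nat.div_dvd_of_dvd χ.conductor_dvd_level))]
    simpa using (χ.primitiveCharacter_apply_of_isCoprime hv').symm
  · rw [χ.map_nonunit fun h ↦ hv ((ZMod.isUnit_iff_coprime v r).1 h).symm]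
    split_ifs with h
    · refine (MulChar.map_nonunit _ fun hu ↦ hv ?_).symm
      rw [← hr]
      exact Nat.Coprime.mul_left ((ZMod.isUnit_iff_coprime v _).1 hu).symm h
    · rfl

theorem Finset.sum_Ico_filter_dvd {M : Type*} [AddCommMonoid M] (f : ℕ → M) {d : ℕ} (hd : 0 < d)
    (a b : ℕ) :
    ∑ v ∈ Ico a b with d ∣ v, f v = ∑ w ∈ Ico (a ⌈/⌉ d) (b ⌈/⌉ d), f (d * w) := by
  symm
  refine sum_bij (fun w _ ↦ d * w) ?_ ?_ ?_ ?_
  · intro w hw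
    obtain ⟨h1, h2⟩ := mem_Ico.1 hw
    rw [mem_filter, mem_Ico]
    refine ⟨⟨?_, ?_⟩, dvd_mul_right _ _⟩
    · simpa using (ceilDiv_le_iff_le_smul hd).1 h1
    · simpa using (lt_iff_lt_of_le_iff_le (ceilDiv_le_iff_le_smul hd)).1 h2
  · intro w _ w' _ h
    exact Nat.eq_of_mul_eq_mul_left hd h
  · intro v hv
    obtain ⟨hv, w, rfl⟩ := mem_filter.1 hv
    obtain ⟨h1, h2⟩ := mem_Ico.1 hv
    exact ⟨w, mem_Ico.2 ⟨(ceilDiv_le_iff_le_smul hd).2 (by simpa using h1),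
      (lt_iff_lt_of_le_iff_le (ceilDiv_le_iff_le_smul hd)).2 (by simpa using h2)⟩, rfl⟩
  · intros; rfl

/-- The **Pólya–Vinogradov inequality** for arbitrary non-principal characters. -/
theorem DirichletCharacter.norm_sum_Ico_le {r : ℕ} [NeZero r] {χ : DirichletCharacter ℂ r}
    (hχ : χ ≠ 1) (a b : ℕ) :
    ‖∑ v ∈ Finset.Ico a b, χ (v : ZMod r)‖ ≤ 2 * √r * (1 + Real.log r) := by
  have hr0 : 0 < r := NeZero.pos r
  have hq1 : χ.conductor ≠ 1 := fun h ↦ hχ (χ.eq_one_iff_conductor_eq_one.2 h)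
  have hqr : χ.conductor ∣ r := χ.conductor_dvd_level
  have : NeZero χ.conductor := ⟨χ.conductor_ne_zero⟩
  set ψ := χ.primitiveCharacter
  set m := r / χ.conductor
  have hmq : m * χ.conductor = r := Nat.div_mul_cancel hqr
  have hm0 : m ≠ 0 := fun h ↦ by simp [h] at hmq; omega
  have hexp : ∑ v ∈ Finset.Ico a b, χ (v : ZMod r)
      = ∑ d ∈ m.divisors, (ArithmeticFunction.moebius d : ℂ) *
          (ψ (d : ZMod χ.conductor) *
            ∑ w ∈ Finset.Ico (a ⌈/⌉ d) (b ⌈/⌉ d), ψ (w : ZMod χ.conductor)) := by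
    calc ∑ v ∈ Finset.Ico a b, χ (v : ZMod r)
        = ∑ v ∈ Finset.Ico a b, ∑ d ∈ m.divisors,
            if d ∣ v then (ArithmeticFunction.moebius d : ℂ) * ψ (v : ZMod χ.conductor)
            else 0 := by
          refine Finset.sum_congr rfl fun v _ ↦ ?_
          rw [← Finset.sum_filter, ← Finset.sum_mul, ← Int.cast_sum,
            Nat.sum_divisors_filter_dvd_moebius hm0, apply_eq_ite_primitiveCharacter]
          split_ifs <;> simp [ψ]
      _ = _ := by
          rw [Finset.sum_comm]
          refine Finset.sum_congr rfl fun d hd ↦ ?_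
          rw [← Finset.sum_filter, Finset.sum_Ico_filter_dvd _ (Nat.pos_of_mem_divisors hd),
            Finset.mul_sum, Finset.mul_sum]
          exact Finset.sum_congr rfl fun w _ ↦ by rw [Nat.cast_mul, map_mul]
  have hlog : Real.log χ.conductor ≤ Real.log r :=
    Real.log_le_log (by exact_mod_cast NeZero.pos χ.conductor)
      (by exact_mod_cast Nat.le_of_dvd hr0 hqr)
  have hlog0 : 0 ≤ Real.log r := Real.log_natCast_nonneg r
  calc ‖∑ v ∈ Finset.Ico a b, χ (v : ZMod r)‖
      ≤ ∑ _d ∈ m.divisors, √χ.conductor * (1 + Real.log r) := by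
        rw [hexp]
        refine norm_sum_le_of_le _ fun d _ ↦ ?_
        rw [norm_mul, norm_mul]
        have hμ : ‖(ArithmeticFunction.moebius d : ℂ)‖ ≤ 1 := by
          rw [Complex.norm_intCast]
          exact_mod_cast ArithmeticFunction.abs_moebius_le_one
        have hS := χ.primitiveCharacter_isPrimitive.norm_sum_Ico_le hq1 (a ⌈/⌉ d) (b ⌈/⌉ d)
        refine (mul_le_of_le_one_left (by positivity) hμ).trans ?_
        refine (mul_le_of_le_one_left (by positivity) (ψ.norm_le_one _)).trans ?_
        exact hS.trans (by gcongr)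
    _ = m.divisors.card * (√χ.conductor * (1 + Real.log r)) := by
        rw [Finset.sum_const, nsmul_eq_mul]
    _ ≤ 2 * √m * (√χ.conductor * (1 + Real.log r)) := by
        gcongr
        exact Nat.card_divisors_le_two_mul_sqrt m
    _ = 2 * √r * (1 + Real.log r) := by
        rw [← mul_assoc, mul_assoc 2, ← Real.sqrt_mul (Nat.cast_nonneg m), ← Nat.cast_mul, hmq]

theorem Finset.inv_card_add_one_le_prod_one_sub_inv (s : Finset ℕ) (hs : ∀ n ∈ s, 2 ≤ n) :
    ((s.card : ℝ) + 1)⁻¹ ≤ ∏ n ∈ s, (1 - (n : ℝ)⁻¹) := by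
  induction s using Finset.induction_on_max with
  | empty => simp
  | insert a s hlt ih =>
    have ha : a ∉ s := fun h ↦ (hlt a h).false
    have hs' : ∀ n ∈ s, 2 ≤ n := fun n hn ↦ hs n (mem_insert_of_mem hn)
    have hcard : s.card + 2 ≤ a := by
      have h2 := hs a (mem_insert_self a s)
      have : s ⊆ Ico 2 a := fun n hn ↦ mem_Ico.2 ⟨hs' n hn, hlt n hn⟩
      have := card_le_card this
      rw [Nat.card_Ico] at this
      omega
    have hcard' : (s.card : ℝ) + 2 ≤ a := by exact_mod_cast hcard
    rw [prod_insert ha, card_insert_of_notMem ha]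
    calc (((s.card + 1 : ℕ) : ℝ) + 1)⁻¹
        = (1 - ((s.card : ℝ) + 2)⁻¹) * ((s.card : ℝ) + 1)⁻¹ := by
          push_cast
          field_simp
          ring
      _ ≤ (1 - (a : ℝ)⁻¹) * ∏ n ∈ s, (1 - (n : ℝ)⁻¹) := by
          have : (a : ℝ)⁻¹ ≤ ((s.card : ℝ) + 2)⁻¹ := inv_anti₀ (by positivity) hcard'
          have h1 : (a : ℝ)⁻¹ ≤ 1 := inv_le_one_of_one_le₀ (by linarith [s.card.cast_nonneg (α := ℝ)])
          exact mul_le_mul (by linarith) (ih hs') (by positivity) (by linarith)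

theorem Nat.card_primeFactors_le_two_mul_log {n : ℕ} (hn : n ≠ 0) :
    (n.primeFactors.card : ℝ) ≤ 2 * Real.log n := by
  have h : 2 ^ n.primeFactors.card ≤ n := by
    calc 2 ^ n.primeFactors.card ≤ ∏ p ∈ n.primeFactors, p :=
          Finset.pow_card_le_prod _ _ _ fun p hp ↦ (Nat.prime_of_mem_primeFactors hp).two_le
      _ ≤ n := Nat.le_of_dvd (Nat.pos_of_ne_zero hn) (Nat.prod_primeFactors_dvd n)
  have h' : ((2 : ℝ) ^ n.primeFactors.card) ≤ n := by exact_mod_cast h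
  have hlog := Real.log_le_log (by positivity) h'
  rw [Real.log_pow] at hlog
  nlinarith [Real.log_two_gt_d9, n.primeFactors.card.cast_nonneg (α := ℝ)]

theorem Nat.inv_two_mul_log_add_one_le_totient_div {n : ℕ} (hn : n ≠ 0) :
    (2 * Real.log n + 1)⁻¹ ≤ (n.totient : ℝ) / n := by
  have hn' : (n : ℝ) ≠ 0 := by exact_mod_cast hn
  have htot : (n.totient : ℝ) / n = ∏ p ∈ n.primeFactors, (1 - (p : ℝ)⁻¹) := by
    have := congrArg (fun x : ℚ ↦ (x : ℝ)) (Nat.totient_eq_mul_prod_factors n)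
    push_cast at this
    rw [this, mul_div_cancel_left₀ _ hn']
  rw [htot]
  refine le_trans (inv_anti₀ (by positivity) ?_) (Finset.inv_card_add_one_le_prod_one_sub_inv _
    fun p hp ↦ (Nat.prime_of_mem_primeFactors hp).two_le)
  linarith [Nat.card_primeFactors_le_two_mul_log hn]

theorem statement4 :
    ∀ ε : ℝ, 0 < ε → ∃ r₀ : ℕ, ∀ r : ℕ, r₀ ≤ r →
      ∀ x y : ℝ, 0 ≤ x → x ≤ y → y ≤ (r : ℝ) → (r : ℝ) ^ (1 - 1 / 100 : ℝ) ≤ y - x →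
      ∀ χ : DirichletCharacter ℝ r, χ ≠ 1 →
      |∑ v ∈ (Finset.range (r + 1)).filter (fun v : ℕ => x ≤ (v : ℝ) ∧ (v : ℝ) ≤ y),
          χ (v : ZMod r)|
        ≤ ε * ((Nat.totient r : ℝ) * (y - x) / r) := by
  intro ε hε
  have hev : ∀ᶠ r : ℕ in Filter.atTop, 484 / ε ≤ (r : ℝ) ^ (29 / 100 : ℝ) :=
    ((tendsto_rpow_atTop (by norm_num)).comp tendsto_natCast_atTop_atTop).eventually_ge_atTop _
  obtain ⟨r₀, hr₀⟩ := Filter.eventually_atTop.1 (hev.and (Filter.eventually_ge_atTop 1))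
  refine ⟨r₀, fun r hr x y hx hxy hyr hlen χ hχ ↦ ?_⟩
  obtain ⟨hbig, hr1⟩ := hr₀ r hr
  have : NeZero r := ⟨by omega⟩
  have hrR : (1 : ℝ) ≤ r := by exact_mod_cast hr1
  have hrpos : (0 : ℝ) < r := by linarith
  have hset : (Finset.range (r + 1)).filter (fun v : ℕ => x ≤ (v : ℝ) ∧ (v : ℝ) ≤ y)
      = Finset.Ico ⌈x⌉₊ (⌊y⌋₊ + 1) := by
    ext v
    have hy : v ≤ ⌊y⌋₊ ↔ (v : ℝ) ≤ y := Nat.le_floor_iff (hx.trans hxy)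
    simp only [Finset.mem_filter, Finset.mem_range, Finset.mem_Ico, Nat.ceil_le, Nat.lt_succ_iff,
      hy]
    refine ⟨fun h ↦ h.2, fun h ↦ ⟨?_, h⟩⟩
    exact_mod_cast h.2.trans hyr
  have hχ' : χ.ringHomComp Complex.ofRealHom ≠ 1 :=
    (MulChar.ringHomComp_ne_one_iff Complex.ofReal_injective).2 hχ
  have hPV := DirichletCharacter.norm_sum_Ico_le hχ' ⌈x⌉₊ (⌊y⌋₊ + 1)
  have hcast : ‖∑ v ∈ Finset.Ico ⌈x⌉₊ (⌊y⌋₊ + 1),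
        (χ.ringHomComp Complex.ofRealHom : DirichletCharacter ℂ r) (v : ZMod r)‖
      = |∑ v ∈ Finset.Ico ⌈x⌉₊ (⌊y⌋₊ + 1), χ (v : ZMod r)| := by
    simp only [MulChar.ringHomComp_apply]
    rw [← map_sum, Complex.ofRealHom_eq_coe, Complex.norm_real, Real.norm_eq_abs]
  rw [hset, ← hcast]
  refine hPV.trans ?_
  have hlog0 : 0 ≤ Real.log r := Real.log_nonneg hrR
  have hlog : 1 + Real.log r ≤ 11 * (r : ℝ) ^ (1 / 10 : ℝ) := by
    have h1 := Real.log_le_rpow_div hrpos.le (show (0 : ℝ) < 1 / 10 by norm_num)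
    have h2 := Real.one_le_rpow hrR (show (0 : ℝ) ≤ 1 / 10 by norm_num)
    linarith
  have htot := Nat.inv_two_mul_log_add_one_le_totient_div (NeZero.ne r)
  have hmain : 2 * √r * (1 + Real.log r) * (2 * Real.log r + 1)
      ≤ ε * (r : ℝ) ^ (1 - 1 / 100 : ℝ) := by
    calc 2 * √r * (1 + Real.log r) * (2 * Real.log r + 1)
        ≤ 2 * √r * (11 * (r : ℝ) ^ (1 / 10 : ℝ)) * (2 * (11 * (r : ℝ) ^ (1 / 10 : ℝ))) := by
          gcongr
          linarith
      _ = 484 * (r : ℝ) ^ (7 / 10 : ℝ) := by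
          have e : (r : ℝ) ^ (7 / 10 : ℝ)
              = √r * ((r : ℝ) ^ (1 / 10 : ℝ) * (r : ℝ) ^ (1 / 10 : ℝ)) := by
            rw [Real.sqrt_eq_rpow, ← Real.rpow_add hrpos, ← Real.rpow_add hrpos]
            norm_num
          rw [e]
          ring
      _ ≤ (ε * (r : ℝ) ^ (29 / 100 : ℝ)) * (r : ℝ) ^ (7 / 10 : ℝ) := by
          gcongr
          rwa [div_le_iff₀' hε] at hbig
      _ = ε * (r : ℝ) ^ (1 - 1 / 100 : ℝ) := by
          rw [mul_assoc, ← Real.rpow_add hrpos]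
          norm_num
  have hpos : 0 < 2 * Real.log r + 1 := by positivity
  calc 2 * √r * (1 + Real.log r)
      ≤ ε * (r : ℝ) ^ (1 - 1 / 100 : ℝ) * (2 * Real.log r + 1)⁻¹ := by
        rwa [← div_eq_mul_inv, le_div_iff₀ hpos]
    _ ≤ ε * (y - x) * (r.totient / r) := by gcongr
    _ = ε * ((Nat.totient r : ℝ) * (y - x) / r) := by ring
end
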